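/- arXiv:math/0512110 — 12 statements merged into one kernel-verified Lean document; each statement's English description precedes it below -/
import Mathlib

section
/- Let X be a locally compact topological space and let U, V be open subsets of X. Then U is way below V in the complete lattice of open subsets of X (Mathlib's TopologicalSpace.Opens X) if and only if there exists a compact subset K ⊆ X with U ⊆ K ⊆ V. -/
/-- `a` is way below `b` in a complete lattice: whenever `b ≤ sSup D` for a nonempty
directed set `D`, already `a ≤ d` for some `d ∈ D`. -/
def wayBelow {L : Type*} [CompleteLattice L] (a b : L) : Prop :=
  ∀ D : Set L, D.Nonempty → DirectedOn (· ≤ ·) D → b ≤ sSup D → ∃ d ∈ D, a ≤ d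

/-- In a locally compact space, `U` is way below `V` in the lattice of open sets iff
there is a compact set `K` interpolating: `U ⊆ K ⊆ V`. -/
theorem opens_wayBelow_iff_exists_compact {X : Type*} [TopologicalSpace X]
    [LocallyCompactSpace X] (U V : TopologicalSpace.Opens X) :
    wayBelow U V ↔ ∃ K : Set X, IsCompact K ∧ (U : Set X) ⊆ K ∧ K ⊆ (V : Set X) := by
  constructor
  · intro h
    obtain ⟨W, ⟨K, hK, hWK, hKV⟩, hUW⟩ := h
      {W | ∃ K : Set X, IsCompact K ∧ (W : Set X) ⊆ K ∧ K ⊆ (V : Set X)}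
      ⟨⊥, ∅, isCompact_empty, by simp, Set.empty_subset _⟩
      (by
        rintro W₁ ⟨K₁, hK₁, hWK₁, hKV₁⟩ W₂ ⟨K₂, hK₂, hWK₂, hKV₂⟩
        exact ⟨W₁ ⊔ W₂, ⟨K₁ ∪ K₂, hK₁.union hK₂, Set.union_subset_union hWK₁ hWK₂,
          Set.union_subset hKV₁ hKV₂⟩, le_sup_left, le_sup_right⟩)
      (by
        intro x hx
        obtain ⟨K, hK, hxK, hKV⟩ := exists_compact_subset V.isOpen hx
        exact TopologicalSpace.Opens.mem_sSup.2
          ⟨⟨interior K, isOpen_interior⟩, ⟨K, hK, interior_subset, hKV⟩, hxK⟩)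
    exact ⟨K, hK, Set.Subset.trans hUW hWK, hKV⟩
  · rintro ⟨K, hK, hUK, hKV⟩ D hD hdir hVD
    have : Nonempty D := hD.to_subtype
    obtain ⟨d, hd⟩ := hK.elim_directed_cover (fun d : D => ((d : TopologicalSpace.Opens X) : Set X))
      (fun d => d.1.isOpen)
      (fun x hx => by
        obtain ⟨d, hd, hxd⟩ := TopologicalSpace.Opens.mem_sSup.1 (hVD (hKV hx))
        exact Set.mem_iUnion.2 ⟨⟨d, hd⟩, hxd⟩)
      hdir.directed_val
    exact ⟨d, d.2, Set.Subset.trans hUK hd⟩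
end

section
/- Let X be a locally compact topological space. Then the complete lattice of open subsets of X (Mathlib's TopologicalSpace.Opens X) is a continuous lattice: every open V satisfies V = sSup {U | U ≪ V}, where ≪ is the way-below relation on open subsets. -/
theorem wayBelow.le {L : Type*} [CompleteLattice L] {a b : L} (h : wayBelow a b) : a ≤ b := by
  obtain ⟨d, rfl, had⟩ := h {b} (Set.singleton_nonempty b) (directedOn_singleton b)
    sSup_singleton.ge
  exact had

/-- An open set is way below any open set separated from it by a compact set. -/
theorem IsCompact.wayBelow_of_subset_of_subset {X : Type*} [TopologicalSpace X] {K : Set X}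
    (hK : IsCompact K) {U V : TopologicalSpace.Opens X} (hUK : (U : Set X) ⊆ K)
    (hKV : K ⊆ V) : wayBelow U V := by
  intro D hne hdir hVD
  have : Nonempty D := hne.to_subtype
  have hcover : K ⊆ ⋃ W : D, ((W : TopologicalSpace.Opens X) : Set X) := by
    intro x hx
    obtain ⟨W, hWD, hxW⟩ := TopologicalSpace.Opens.mem_sSup.mp (hVD (hKV hx))
    exact Set.mem_iUnion.mpr ⟨⟨W, hWD⟩, hxW⟩
  obtain ⟨W, hKW⟩ := hK.elim_directed_cover _ (fun W : D => W.1.isOpen) hcover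
    hdir.directed_val
  exact ⟨W, W.2, hUK.trans hKW⟩

/-- The topology of a locally compact space is a continuous lattice:
every open `V` is the supremum of the opens way below it. -/
theorem opens_continuous_lattice {X : Type*} [TopologicalSpace X]
    [LocallyCompactSpace X] (V : TopologicalSpace.Opens X) :
    V = sSup {U : TopologicalSpace.Opens X | wayBelow U V} := by
  refine le_antisymm (fun x hx => ?_) (sSup_le fun U hU => wayBelow.le hU)
  obtain ⟨K, hKx, hKV, hK⟩ := local_compact_nhds (V.isOpen.mem_nhds hx)
  exact TopologicalSpace.Opens.mem_sSup.mpr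
    ⟨⟨interior K, isOpen_interior⟩, hK.wayBelow_of_subset_of_subset interior_subset hKV,
      mem_interior_iff_mem_nhds.mpr hKx⟩
end

section
/- Let L be a continuous lattice and let α, β, γ ∈ L with α ≪ β ⊔ γ. Then there exist β', γ' ∈ L with β' ≪ β, γ' ≪ γ, and α ≪ β' ⊔ γ'. -/
namespace wayBelow

variable {L : Type*} [CompleteLattice L] {a b c d : L}

theorem mono (hab : a ≤ b) (hcd : c ≤ d) (h : wayBelow b c) : wayBelow a d := by
  intro D hne hdir hle
  obtain ⟨x, hx, hbx⟩ := h D hne hdir (hcd.trans hle)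
  exact ⟨x, hx, hab.trans hbx⟩

theorem bot_left (a : L) : wayBelow ⊥ a :=
  fun _ ⟨x, hx⟩ _ _ => ⟨x, hx, bot_le⟩

theorem sup_left (ha : wayBelow a c) (hb : wayBelow b c) : wayBelow (a ⊔ b) c := by
  intro D hne hdir hle
  obtain ⟨x, hx, hax⟩ := ha D hne hdir hle
  obtain ⟨y, hy, hby⟩ := hb D hne hdir hle
  obtain ⟨z, hz, hxz, hyz⟩ := hdir x hx y hy
  exact ⟨z, hz, sup_le (hax.trans hxz) (hby.trans hyz)⟩

end wayBelow

/-- The Wilker property for continuous lattices: if `α ≪ β ⊔ γ` then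
`α ≪ β' ⊔ γ'` for some `β' ≪ β` and `γ' ≪ γ`. -/
theorem wayBelow_sup_wilker {L : Type*} [CompleteLattice L]
    (hcont : ∀ φ : L, φ = sSup {β | wayBelow β φ})
    (α β γ : L) (h : wayBelow α (β ⊔ γ)) :
    ∃ β' γ' : L, wayBelow β' β ∧ wayBelow γ' γ ∧ wayBelow α (β' ⊔ γ') := by
  let D : Set L := {δ | ∃ b c, wayBelow b β ∧ wayBelow c γ ∧ wayBelow δ (b ⊔ c)}
  have hne : D.Nonempty := ⟨⊥, ⊥, ⊥, .bot_left β, .bot_left γ, .bot_left _⟩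
  have hdir : DirectedOn (· ≤ ·) D := by
    rintro x ⟨b₁, c₁, hb₁, hc₁, hx⟩ y ⟨b₂, c₂, hb₂, hc₂, hy⟩
    refine ⟨x ⊔ y, ⟨b₁ ⊔ b₂, c₁ ⊔ c₂, hb₁.sup_left hb₂, hc₁.sup_left hc₂, ?_⟩,
      le_sup_left, le_sup_right⟩
    exact (hx.mono le_rfl (sup_le_sup le_sup_left le_sup_left)).sup_left
      (hy.mono le_rfl (sup_le_sup le_sup_right le_sup_right))
  have hle : ∀ b c, wayBelow b β → wayBelow c γ → b ⊔ c ≤ sSup D := by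
    intro b c hb hc
    rw [hcont (b ⊔ c)]
    exact sSup_le_sSup fun δ hδ => ⟨b, c, hb, hc, hδ⟩
  have hβ : β ≤ sSup D := by
    rw [hcont β]
    exact sSup_le fun b hb => le_sup_left.trans (hle b ⊥ hb (.bot_left γ))
  have hγ : γ ≤ sSup D := by
    rw [hcont γ]
    exact sSup_le fun c hc => le_sup_right.trans (hle ⊥ c (.bot_left β) hc)
  obtain ⟨δ, ⟨b, c, hb, hc, hδ⟩, hαδ⟩ := h D hne hdir (sup_le hβ hγ)
  exact ⟨b, c, hb, hc, hδ.mono hαδ le_rfl⟩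
end

section
/- Let X be a sober topological space and let 𝓕 be a collection of open subsets of X which is a filter (X ∈ 𝓕; if U, V ∈ 𝓕 then U ∩ V ∈ 𝓕; if U ∈ 𝓕, V is open and U ⊆ V then V ∈ 𝓕) and which is Scott-open: for every nonempty family of open sets directed under inclusion whose union belongs to 𝓕, some member of the family already belongs to 𝓕. Then K := ⋂ 𝓕 is a compact subset of X, and 𝓕 = {U | U open and K ⊆ U}. -/
/-- An open set containing the intersection of a Scott-open filter of open sets of a quasi-sober
space belongs to the filter. -/
theorem mem_of_sInter_subset_of_scottOpen {X : Type*} [TopologicalSpace X] [QuasiSober X]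
    {𝓕 : Set (Set X)}
    (huniv : Set.univ ∈ 𝓕)
    (hinter : ∀ U ∈ 𝓕, ∀ V ∈ 𝓕, U ∩ V ∈ 𝓕)
    (hup : ∀ U ∈ 𝓕, ∀ V : Set X, IsOpen V → U ⊆ V → V ∈ 𝓕)
    (hopen : ∀ U ∈ 𝓕, IsOpen U)
    (hscott : ∀ D : Set (Set X), D.Nonempty → (∀ U ∈ D, IsOpen U) →
      DirectedOn (· ⊆ ·) D → ⋃₀ D ∈ 𝓕 → ∃ U ∈ D, U ∈ 𝓕)
    {U : Set X} (hU : IsOpen U) (hKU : ⋂₀ 𝓕 ⊆ U) : U ∈ 𝓕 := by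
  by_contra hU𝓕
  obtain ⟨M, hUM, ⟨hMo, hM𝓕⟩, hmax⟩ := zorn_subset_nonempty {V : Set X | IsOpen V ∧ V ∉ 𝓕}
    (fun c hc hchain hne => by
      refine ⟨⋃₀ c, ⟨isOpen_sUnion fun V hV => (hc hV).1, fun hmem => ?_⟩,
        fun _ => Set.subset_sUnion_of_mem⟩
      obtain ⟨V, hVc, hV𝓕⟩ := hscott c hne (fun V hV => (hc hV).1) hchain.directedOn hmem
      exact (hc hVc).2 hV𝓕) U ⟨hU, hU𝓕⟩
  have union_mem : ∀ u : Set X, IsOpen u → (Mᶜ ∩ u).Nonempty → M ∪ u ∈ 𝓕 := by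
    rintro u hu ⟨x, hxM, hxu⟩
    by_contra hmem
    exact hxM (hmax ⟨hMo.union hu, hmem⟩ Set.subset_union_left (Or.inr hxu))
  have hirr : IsIrreducible Mᶜ := by
    refine ⟨Set.nonempty_compl.2 fun h => hM𝓕 (h ▸ huniv), fun u v hu hv hMu hMv => ?_⟩
    by_contra hempty
    refine hM𝓕 (hup _ (hinter _ (union_mem u hu hMu) _ (union_mem v hv hMv)) M hMo ?_)
    rw [← Set.union_inter_distrib_left]
    refine Set.union_subset subset_rfl fun x hx => ?_
    by_contra hxM
    exact hempty ⟨x, hxM, hx⟩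
  obtain ⟨x, hx⟩ := QuasiSober.sober hirr hMo.isClosed_compl
  refine hx.mem (hUM (hKU fun W hW => ?_))
  by_contra hxW
  exact hM𝓕 (hup W hW M hMo
    (Set.disjoint_compl_left_iff_subset.1 ((hx.disjoint_iff (hopen W hW)).2 hxW)))

/-- **Hofmann–Mislove theorem.** In a sober space, a Scott-open filter `𝓕` of open sets
has compact intersection `K`, and `𝓕` consists exactly of the open neighbourhoods of `K`. -/
theorem hofmann_mislove {X : Type*} [TopologicalSpace X] [T0Space X] [QuasiSober X]
    (𝓕 : Set (Set X))
    (hopen : ∀ U ∈ 𝓕, IsOpen U)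
    (huniv : Set.univ ∈ 𝓕)
    (hinter : ∀ U ∈ 𝓕, ∀ V ∈ 𝓕, U ∩ V ∈ 𝓕)
    (hup : ∀ U ∈ 𝓕, ∀ V : Set X, IsOpen V → U ⊆ V → V ∈ 𝓕)
    (hscott : ∀ D : Set (Set X), D.Nonempty → (∀ U ∈ D, IsOpen U) →
      DirectedOn (· ⊆ ·) D → ⋃₀ D ∈ 𝓕 → ∃ U ∈ D, U ∈ 𝓕) :
    IsCompact (⋂₀ 𝓕) ∧ 𝓕 = {U : Set X | IsOpen U ∧ ⋂₀ 𝓕 ⊆ U} := by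
  have mem_of_subset : ∀ U : Set X, IsOpen U → ⋂₀ 𝓕 ⊆ U → U ∈ 𝓕 := fun _ =>
    mem_of_sInter_subset_of_scottOpen huniv hinter hup hopen hscott
  refine ⟨isCompact_of_finite_subcover fun {ι} U hUo hKU => ?_, Set.Subset.antisymm
    (fun U hU => ⟨hopen U hU, Set.sInter_subset_of_mem hU⟩) fun U hU => mem_of_subset U hU.1 hU.2⟩
  have hmono : Monotone fun t : Finset ι => ⋃ i ∈ t, U i :=
    fun _ _ hst => Set.biUnion_subset_biUnion_left hst
  obtain ⟨_, ⟨t, rfl⟩, ht⟩ := hscott (Set.range fun t : Finset ι => ⋃ i ∈ t, U i)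
    (Set.range_nonempty _)
    (by rintro _ ⟨t, rfl⟩; exact isOpen_biUnion fun i _ => hUo i)
    (directedOn_range.2 hmono.directed_le)
    (by
      rw [Set.sUnion_range, ← Set.iUnion_eq_iUnion_finset]
      exact mem_of_subset _ (isOpen_iUnion hUo) hKU)
  exact ⟨t, Set.sInter_subset_of_mem ht⟩
end

section
/- Let X be a sober topological space, ι a nonempty index type, and K : ι → Set X a family of compact saturated subsets that is codirected: for all s, t there exists u with K u ⊆ K s ∩ K t. Then ⋂ s, K s is compact and saturated; for every open U ⊆ X with ⋂ s, K s ⊆ U there exists s with K s ⊆ U; and if every K s is nonempty then ⋂ s, K s is nonempty. -/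
open Set

/-- A closed set meeting every member of a codirected family of compact sets contains
an irreducible closed set with the same property. -/
theorem exists_isIrreducible_isClosed_subset_of_codirected_isCompact {X : Type*}
    [TopologicalSpace X] {ι : Type*} [Nonempty ι] {K : ι → Set X}
    (hcpt : ∀ s, IsCompact (K s)) (hdir : ∀ s t, ∃ u, K u ⊆ K s ∩ K t)
    {F : Set X} (hF : IsClosed F) (hFK : ∀ s, (K s ∩ F).Nonempty) :
    ∃ C ⊆ F, IsClosed C ∧ IsIrreducible C ∧ ∀ s, (K s ∩ C).Nonempty := by
  obtain ⟨C, hCF, hC⟩ := zorn_superset_nonempty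
    {C : Set X | IsClosed C ∧ ∀ s, (K s ∩ C).Nonempty} (fun c hc hchain hne ↦ by
      refine ⟨⋂₀ c, ⟨isClosed_sInter fun D hD ↦ (hc hD).1, fun s ↦ ?_⟩,
        fun D hD ↦ sInter_subset_of_mem hD⟩
      have := hne.to_subtype
      by_contra hempty
      rw [not_nonempty_iff_eq_empty, sInter_eq_iInter] at hempty
      obtain ⟨D, hD⟩ := (hcpt s).elim_directed_family_closed
        (fun D : c ↦ (D : Set X)) (fun D ↦ (hc D.2).1) hempty
        (show IsChain (· ⊇ ·) c from hchain.symm).directedOn.directed_val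
      exact ((hc D.2).2 s).ne_empty hD) F ⟨hF, hFK⟩
  obtain ⟨hCclosed, hCK⟩ := hC.prop
  refine ⟨C, hCF, hCclosed,
    ⟨(hCK (Classical.arbitrary ι)).mono inter_subset_right, ?_⟩, hCK⟩
  have exists_disjoint : ∀ A : Set X, IsClosed A → ¬ C ⊆ A → ∃ s, ¬ (K s ∩ (C ∩ A)).Nonempty := by
    intro A hA hCA
    by_contra! h
    exact hCA ((hC.le_of_le ⟨hCclosed.inter hA, h⟩ inter_subset_left).trans inter_subset_right)
  rw [isPreirreducible_iff_isClosed_union_isClosed]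
  intro A B hA hB hCAB
  by_contra! h
  obtain ⟨s, hs⟩ := exists_disjoint A hA h.1
  obtain ⟨t, ht⟩ := exists_disjoint B hB h.2
  obtain ⟨u, hu⟩ := hdir s t
  obtain ⟨x, hxK, hxC⟩ := hCK u
  rcases hCAB hxC with hx | hx
  · exact hs ⟨x, (hu hxK).1, hxC, hx⟩
  · exact ht ⟨x, (hu hxK).2, hxC, hx⟩

/-- Quasi-sober spaces are well-filtered. -/
theorem exists_subset_of_iInter_subset_of_isCompact_of_nhdsKer_subset {X : Type*}
    [TopologicalSpace X] [QuasiSober X] {ι : Type*} [Nonempty ι] {K : ι → Set X}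
    (hcpt : ∀ s, IsCompact (K s)) (hsat : ∀ s, nhdsKer (K s) ⊆ K s)
    (hdir : ∀ s t, ∃ u, K u ⊆ K s ∩ K t)
    {U : Set X} (hU : IsOpen U) (hKU : ⋂ s, K s ⊆ U) : ∃ s, K s ⊆ U := by
  by_contra! h
  obtain ⟨C, hCU, hCclosed, hCirr, hCK⟩ :=
    exists_isIrreducible_isClosed_subset_of_codirected_isCompact hcpt hdir hU.isClosed_compl
      fun s ↦ inter_compl_nonempty_iff.2 (h s)
  obtain ⟨x, hx⟩ := QuasiSober.sober hCirr hCclosed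
  refine hCU hx.mem (hKU (mem_iInter.2 fun s ↦ hsat s ?_))
  obtain ⟨y, hyK, hyC⟩ := hCK s
  exact mem_nhdsKer_iff_specializes.2 ⟨y, hyK, hx.specializes hyC⟩


/-- In a sober space, a codirected intersection of compact saturated sets is compact
saturated; any open set containing the intersection contains one of the members;
and the intersection of nonempty members is nonempty. -/
theorem codirected_inter_compact_saturated {X : Type*} [TopologicalSpace X]
    [T0Space X] [QuasiSober X] {ι : Type*} [Nonempty ι] (K : ι → Set X)
    (hcpt : ∀ s, IsCompact (K s))
    (hsat : ∀ s, K s = ⋂₀ {U : Set X | IsOpen U ∧ K s ⊆ U})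
    (hdir : ∀ s t, ∃ u, K u ⊆ K s ∩ K t) :
    IsCompact (⋂ s, K s) ∧
    (⋂ s, K s) = ⋂₀ {U : Set X | IsOpen U ∧ (⋂ s, K s) ⊆ U} ∧
    (∀ U : Set X, IsOpen U → (⋂ s, K s) ⊆ U → ∃ s, K s ⊆ U) ∧
    ((∀ s, (K s).Nonempty) → (⋂ s, K s).Nonempty) := by
  have hker : ∀ s, nhdsKer (K s) ⊆ K s := fun s ↦ by
    rw [nhdsKer_def]
    exact (hsat s).symm.subset
  have exists_subset : ∀ U : Set X, IsOpen U → (⋂ s, K s) ⊆ U → ∃ s, K s ⊆ U :=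
    fun U hU hKU ↦
      exists_subset_of_iInter_subset_of_isCompact_of_nhdsKer_subset hcpt hker hdir hU hKU
  refine ⟨?_, ?_, exists_subset, fun hne ↦ ?_⟩
  · refine isCompact_of_finite_subcover fun V hV hKV ↦ ?_
    obtain ⟨s, hs⟩ := exists_subset _ (isOpen_iUnion hV) hKV
    obtain ⟨F, hF⟩ := (hcpt s).elim_finite_subcover V hV hs
    exact ⟨F, (iInter_subset K s).trans hF⟩
  · rw [← nhdsKer_def]
    exact subset_nhdsKer.antisymm (nhdsKer_iInter_subset.trans (iInter_mono hker))
  · by_contra hempty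
    obtain ⟨s, hs⟩ := exists_subset ∅ isOpen_empty (not_nonempty_iff_eq_empty.1 hempty).subset
    exact (hne s).ne_empty (subset_empty_iff.1 hs)
end

section
/- Let X be a locally compact sober topological space and let K ⊆ X be compact and saturated. Then K = ⋂ {L | L is compact and saturated, and there exists an open U with K ⊆ U ⊆ L}. -/
/-- In a locally compact sober space, a compact saturated set `K` is the intersection of
the compact saturated sets `L` that are "way below" it, i.e. such that `K ⊆ U ⊆ L`
for some open `U`. -/
theorem compact_saturated_eq_inter_wayBelow {X : Type*} [TopologicalSpace X]
    [LocallyCompactSpace X] [T0Space X] [QuasiSober X]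
    {K : Set X} (hK : IsCompact K)
    (hsat : K = ⋂₀ {U : Set X | IsOpen U ∧ K ⊆ U}) :
    K = ⋂₀ {L : Set X | IsCompact L ∧ (L = ⋂₀ {U : Set X | IsOpen U ∧ L ⊆ U}) ∧
          ∃ U : Set X, IsOpen U ∧ K ⊆ U ∧ U ⊆ L} := by
  refine Set.Subset.antisymm (Set.subset_sInter ?_) ?_
  · rintro L ⟨-, -, U, -, hKU, hUL⟩
    exact hKU.trans hUL
  · intro x hx
    rw [hsat]
    rintro V ⟨hV, hKV⟩
    obtain ⟨L, hL, hKL, hLV⟩ := exists_compact_between hK hV hKV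
    refine hV.nhdsKer_subset.2 hLV (hx (nhdsKer L) ⟨IsCompact.nhdsKer_iff.2 hL, ?_,
      interior L, isOpen_interior, hKL, interior_subset.trans subset_nhdsKer⟩)
    rw [← nhdsKer_def, nhdsKer_nhdsKer]
end

section
/- Let X be a locally compact sober topological space and let K, L ⊆ X be compact saturated subsets. Then the following are equivalent: (i) there exists an open set U with K ⊆ U ⊆ L; (ii) for every nonempty codirected family (M_s) of compact saturated subsets of X (for all s, t there is u with M_u ⊆ M_s ∩ M_t) satisfying ⋂ s, M_s ⊆ K, there exists s with M_s ⊆ L. (This says that L is way above K in the lattice of compact saturated subsets ordered by reverse inclusion.) -/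
open Set

/-- Sober spaces are well-filtered: if the intersection of a nonempty codirected family of compact
saturated sets lies in an open set, then so does some member of the family. -/
theorem QuasiSober.exists_subset_of_sInter_subset {X : Type*} [TopologicalSpace X] [QuasiSober X]
    {𝒟 : Set (Set X)} (hne : 𝒟.Nonempty) (hcomp : ∀ M ∈ 𝒟, IsCompact M)
    (hsat : ∀ M ∈ 𝒟, nhdsKer M ⊆ M)
    (hdir : ∀ M₁ ∈ 𝒟, ∀ M₂ ∈ 𝒟, ∃ M₃ ∈ 𝒟, M₃ ⊆ M₁ ∩ M₂)
    {U : Set X} (hU : IsOpen U) (hsub : ⋂₀ 𝒟 ⊆ U) : ∃ M ∈ 𝒟, M ⊆ U := by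
  by_contra! hcon
  obtain ⟨V, hUV, ⟨hV, hVM⟩, hmax⟩ :=
    zorn_subset_nonempty {V : Set X | IsOpen V ∧ ∀ M ∈ 𝒟, ¬ M ⊆ V} (fun c hc hchain hcne ↦ by
      refine ⟨⋃₀ c, ⟨isOpen_sUnion fun V hVc ↦ (hc hVc).1, fun M hM hMc ↦ ?_⟩,
        fun V hVc ↦ subset_sUnion_of_mem hVc⟩
      have := hcne.to_subtype
      obtain ⟨⟨V, hVc⟩, hMV⟩ := (hcomp M hM).elim_directed_cover (fun V : c ↦ (V : Set X))
        (fun V ↦ (hc V.2).1) (hMc.trans sUnion_eq_iUnion.subset) hchain.directedOn.directed_val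
      exact (hc hVc).2 M hM hMV) U ⟨hU, hcon⟩
  have henlarge : ∀ O : Set X, IsOpen O → (Vᶜ ∩ O).Nonempty → ∃ M ∈ 𝒟, M ⊆ V ∪ O := by
    rintro O hO ⟨x, hxV, hxO⟩
    by_contra! h
    exact hxV (hmax ⟨hV.union hO, h⟩ subset_union_left (Or.inr hxO))
  have hirr : IsIrreducible Vᶜ := by
    refine ⟨?_, fun O₁ O₂ hO₁ hO₂ h₁ h₂ ↦ ?_⟩
    · obtain ⟨M, hM⟩ := hne
      obtain ⟨x, -, hx⟩ := not_subset.1 (hVM M hM)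
      exact ⟨x, hx⟩
    · obtain ⟨M₁, hM₁, hM₁O⟩ := henlarge O₁ hO₁ h₁
      obtain ⟨M₂, hM₂, hM₂O⟩ := henlarge O₂ hO₂ h₂
      obtain ⟨M₃, hM₃, hM₃s⟩ := hdir M₁ hM₁ M₂ hM₂
      obtain ⟨x, hxM, hxV⟩ := not_subset.1 (hVM M₃ hM₃)
      exact ⟨x, hxV, (hM₁O (hM₃s hxM).1).resolve_left hxV, (hM₂O (hM₃s hxM).2).resolve_left hxV⟩
  obtain ⟨x, hx⟩ := QuasiSober.sober hirr hV.isClosed_compl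
  have hxV : x ∈ Vᶜ := hx.mem
  refine hxV (hUV (hsub fun M hM ↦ hsat M hM ?_))
  obtain ⟨y, hyM, hyV⟩ := not_subset.1 (hVM M hM)
  exact mem_nhdsKer_iff_specializes.2 ⟨y, hyM, hx.specializes hyV⟩

/-- In a locally compact space, a compact saturated set `K` has an open neighbourhood inside `L`
as soon as `L` is way above `K`. -/
theorem IsCompact.exists_isOpen_between_of_wayAbove {X : Type*} [TopologicalSpace X]
    [LocallyCompactSpace X] {K L : Set X} (hK : IsCompact K) (hKsat : nhdsKer K ⊆ K)
    (h : ∀ 𝒟 : Set (Set X), 𝒟.Nonempty → (∀ M ∈ 𝒟, IsCompact M ∧ M = nhdsKer M) →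
      (∀ M₁ ∈ 𝒟, ∀ M₂ ∈ 𝒟, ∃ M₃ ∈ 𝒟, M₃ ⊆ M₁ ∩ M₂) → ⋂₀ 𝒟 ⊆ K → ∃ M ∈ 𝒟, M ⊆ L) :
    ∃ U : Set X, IsOpen U ∧ K ⊆ U ∧ U ⊆ L := by
  suffices ∃ M ∈ nhdsKer '' {C : Set X | IsCompact C ∧ K ⊆ interior C}, M ⊆ L by
    obtain ⟨_, ⟨C, ⟨-, hKC⟩, rfl⟩, hCL⟩ := this
    exact ⟨interior C, isOpen_interior, hKC, interior_subset.trans (subset_nhdsKer.trans hCL)⟩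
  refine h _ ?_ ?_ ?_ ?_
  · obtain ⟨C, hC, hKC, -⟩ := exists_compact_between hK isOpen_univ (subset_univ K)
    exact ⟨_, C, ⟨hC, hKC⟩, rfl⟩
  · rintro _ ⟨C, ⟨hC, -⟩, rfl⟩
    exact ⟨hC.nhdsKer, (nhdsKer_nhdsKer C).symm⟩
  · rintro _ ⟨C₁, ⟨-, hKC₁⟩, rfl⟩ _ ⟨C₂, ⟨-, hKC₂⟩, rfl⟩
    obtain ⟨C, hC, hKC, hCs⟩ := exists_compact_between hK
      (isOpen_interior.inter isOpen_interior) (subset_inter hKC₁ hKC₂)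
    exact ⟨_, ⟨C, ⟨hC, hKC⟩, rfl⟩, subset_inter
      (nhdsKer_mono fun x hx ↦ interior_subset (hCs hx).1)
      (nhdsKer_mono fun x hx ↦ interior_subset (hCs hx).2)⟩
  · refine fun x hx ↦ hKsat (mem_nhdsKer.2 fun U hU hKU ↦ ?_)
    obtain ⟨C, hC, hKC, hCU⟩ := exists_compact_between hK hU hKU
    exact nhdsKer_minimal hCU hU (hx _ ⟨C, ⟨hC, hKC⟩, rfl⟩)

/-- In a locally compact sober space, for compact saturated sets `K`, `L`, the existence
of an open `U` with `K ⊆ U ⊆ L` is equivalent to `L` being way above `K` in the lattice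
of compact saturated sets under reverse inclusion: every nonempty codirected family of
compact saturated sets whose intersection is contained in `K` has a member contained
in `L`. -/
theorem compact_saturated_wayBelow_iff {X : Type*} [TopologicalSpace X]
    [LocallyCompactSpace X] [T0Space X] [QuasiSober X] {K L : Set X}
    (hK : IsCompact K) (hKsat : K = ⋂₀ {U : Set X | IsOpen U ∧ K ⊆ U})
    (hL : IsCompact L) (hLsat : L = ⋂₀ {U : Set X | IsOpen U ∧ L ⊆ U}) :
    (∃ U : Set X, IsOpen U ∧ K ⊆ U ∧ U ⊆ L) ↔
    (∀ 𝒟 : Set (Set X), 𝒟.Nonempty →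
      (∀ M ∈ 𝒟, IsCompact M ∧ M = ⋂₀ {U : Set X | IsOpen U ∧ M ⊆ U}) →
      (∀ M₁ ∈ 𝒟, ∀ M₂ ∈ 𝒟, ∃ M₃ ∈ 𝒟, M₃ ⊆ M₁ ∩ M₂) →
      ⋂₀ 𝒟 ⊆ K → ∃ M ∈ 𝒟, M ⊆ L) := by
  simp only [← nhdsKer_def] at *
  refine ⟨?_, hK.exists_isOpen_between_of_wayAbove hKsat.ge⟩
  rintro ⟨U, hU, hKU, hUL⟩ 𝒟 hne h𝒟 hdir hsub
  obtain ⟨M, hM, hMU⟩ := QuasiSober.exists_subset_of_sInter_subset hne (fun M hM ↦ (h𝒟 M hM).1)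
    (fun M hM ↦ (h𝒟 M hM).2.ge) hdir hU (hsub.trans hKU)
  exact ⟨M, hM, hMU.trans hUL⟩
end

section
/- Let X be a stably locally compact sober topological space: X is locally compact, sober, compact as a whole space, and the intersection of any two compact subsets of X is compact. Let K, L ⊆ X be compact saturated subsets and U ⊆ X open with K ∩ L ⊆ U. Then there exist open subsets V, W and compact subsets K', L' of X such that K ⊆ V ⊆ K', L ⊆ W ⊆ L', and K' ∩ L' ⊆ U. -/
/-- In a quasi-sober space, an open set containing the intersection of a filtered family of
compact sets closed under generalization already contains a member of the family. -/
theorem exists_subset_of_directed_isCompact_of_iInter_subset {X ι : Type*} [TopologicalSpace X]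
    [QuasiSober X] [Nonempty ι] {C : ι → Set X} (hdir : Directed (· ⊇ ·) C)
    (hC : ∀ i, IsCompact (C i)) (hgen : ∀ i, StableUnderGeneralization (C i))
    {U : Set X} (hU : IsOpen U) (hCU : ⋂ i, C i ⊆ U) : ∃ i, C i ⊆ U := by
  by_contra! hne
  let S : Set (Set X) := {A | IsClosed A ∧ A ⊆ Uᶜ ∧ ∀ i, (C i ∩ A).Nonempty}
  have hUS : Uᶜ ∈ S :=
    ⟨hU.isClosed_compl, subset_rfl, fun i ↦ Set.inter_compl_nonempty_iff.2 (hne i)⟩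
  obtain ⟨A, -, hA⟩ := zorn_superset_nonempty S (fun c hcS hc hcne ↦ by
    refine ⟨⋂₀ c, ⟨isClosed_sInter fun s hs ↦ (hcS hs).1, ?_, fun i ↦ ?_⟩,
      fun s hs ↦ Set.sInter_subset_of_mem hs⟩
    · obtain ⟨s, hs⟩ := hcne
      exact (Set.sInter_subset_of_mem hs).trans (hcS hs).2.1
    · have := hcne.to_subtype
      rw [Set.sInter_eq_iInter]
      refine (hC i).inter_iInter_nonempty _ (fun s ↦ (hcS s.2).1) fun t ↦ ?_
      have hcdir : Directed (· ⊇ ·) (Subtype.val : c → Set X) := fun s t ↦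
        (hc.total s.2 t.2).elim (fun h ↦ ⟨s, subset_rfl, h⟩) fun h ↦ ⟨t, h, subset_rfl⟩
      obtain ⟨s, hs⟩ := hcdir.finset_le t
      exact ((hcS s.2).2.2 i).mono
        (Set.inter_subset_inter_right _ (Set.subset_iInter₂ hs))) _ hUS
  obtain ⟨⟨hAcl, hAU, hAC⟩, hmin⟩ := hA
  have hirr : IsIrreducible A := by
    refine ⟨(hAC (Classical.arbitrary ι)).mono Set.inter_subset_right,
      isPreirreducible_iff_isClosed_union_isClosed.2 fun Z₁ Z₂ h₁ h₂ hZ ↦ ?_⟩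
    have key : ∀ Z, IsClosed Z → ¬A ⊆ Z → ∃ i, ¬(C i ∩ (A ∩ Z)).Nonempty := by
      intro Z hZ hAZ
      by_contra! h
      exact hAZ ((hmin ⟨hAcl.inter hZ, Set.inter_subset_left.trans hAU, h⟩
        Set.inter_subset_left).trans Set.inter_subset_right)
    by_contra! h
    obtain ⟨i, hi⟩ := key Z₁ h₁ h.1
    obtain ⟨j, hj⟩ := key Z₂ h₂ h.2
    obtain ⟨k, hki, hkj⟩ := hdir i j
    obtain ⟨x, hxC, hxA⟩ := hAC k
    rcases hZ hxA with hx | hx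
    · exact hi ⟨x, hki hxC, hxA, hx⟩
    · exact hj ⟨x, hkj hxC, hxA, hx⟩
  obtain ⟨x, hx⟩ := QuasiSober.sober hirr hAcl
  refine hAU hx.mem (hCU (Set.mem_iInter.2 fun i ↦ ?_))
  obtain ⟨y, hyC, hyA⟩ := hAC i
  exact hgen i (hx.specializes hyA) hyC

theorem stableUnderGeneralization_nhdsKer {X : Type*} [TopologicalSpace X] (s : Set X) :
    StableUnderGeneralization (nhdsKer s) := by
  intro x y hyx hx
  rw [mem_nhdsKer] at hx ⊢
  exact fun V hV hsV ↦ hyx.mem_open hV (hx V hV hsV)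


/-- **Dual Wilker property** for stably locally compact sober spaces: if compact
saturated sets satisfy `K ∩ L ⊆ U` with `U` open, the situation interpolates through
opens `V`, `W` and compacts `K'`, `L'` with `K ⊆ V ⊆ K'`, `L ⊆ W ⊆ L'` and
`K' ∩ L' ⊆ U`. -/
theorem dual_wilker {X : Type*} [TopologicalSpace X] [LocallyCompactSpace X]
    [T0Space X] [QuasiSober X] [CompactSpace X]
    (hstab : ∀ K L : Set X, IsCompact K → IsCompact L → IsCompact (K ∩ L))
    {K L U : Set X}
    (hK : IsCompact K) (hKsat : K = ⋂₀ {V : Set X | IsOpen V ∧ K ⊆ V})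
    (hL : IsCompact L) (hLsat : L = ⋂₀ {V : Set X | IsOpen V ∧ L ⊆ V})
    (hU : IsOpen U) (hKL : K ∩ L ⊆ U) :
    ∃ V W K' L' : Set X, IsOpen V ∧ IsOpen W ∧ IsCompact K' ∧ IsCompact L' ∧
      K ⊆ V ∧ V ⊆ K' ∧ L ⊆ W ∧ W ⊆ L' ∧ K' ∩ L' ⊆ U := by
  let ι := {p : Set X × Set X //
    (IsCompact p.1 ∧ K ⊆ interior p.1) ∧ IsCompact p.2 ∧ L ⊆ interior p.2}
  have : Nonempty ι := ⟨(Set.univ, Set.univ), by simp [isCompact_univ]⟩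
  let C : ι → Set X := fun p ↦ nhdsKer p.1.1 ∩ nhdsKer p.1.2
  have hdir : Directed (· ⊇ ·) C := by
    rintro ⟨⟨A, B⟩, ⟨hA, hKA⟩, hB, hLB⟩ ⟨⟨A', B'⟩, ⟨hA', hKA'⟩, hB', hLB'⟩
    refine ⟨⟨(A ∩ A', B ∩ B'), ⟨hstab _ _ hA hA', ?_⟩, hstab _ _ hB hB', ?_⟩, ?_, ?_⟩
    · simpa using ⟨hKA, hKA'⟩
    · simpa using ⟨hLB, hLB'⟩
    · exact Set.inter_subset_inter (nhdsKer_mono Set.inter_subset_left)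
        (nhdsKer_mono Set.inter_subset_left)
    · exact Set.inter_subset_inter (nhdsKer_mono Set.inter_subset_right)
        (nhdsKer_mono Set.inter_subset_right)
  have hCU : ⋂ p, C p ⊆ U := by
    intro x hx
    rw [Set.mem_iInter] at hx
    refine hKL ⟨?_, ?_⟩
    · rw [hKsat]
      rintro V ⟨hV, hKV⟩
      obtain ⟨A, hA, hKA, hAV⟩ := exists_compact_between hK hV hKV
      exact nhdsKer_minimal hAV hV
        (hx ⟨(A, Set.univ), ⟨hA, hKA⟩, isCompact_univ, by simp⟩).1
    · rw [hLsat]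
      rintro V ⟨hV, hLV⟩
      obtain ⟨B, hB, hLB, hBV⟩ := exists_compact_between hL hV hLV
      exact nhdsKer_minimal hBV hV
        (hx ⟨(Set.univ, B), ⟨isCompact_univ, by simp⟩, hB, hLB⟩).2
  obtain ⟨⟨⟨A, B⟩, ⟨hA, hKA⟩, hB, hLB⟩, hAB⟩ :=
    exists_subset_of_directed_isCompact_of_iInter_subset hdir
      (fun p ↦ hstab _ _ p.2.1.1.nhdsKer p.2.2.1.nhdsKer)
      (fun p _ _ hyx hx ↦ ⟨stableUnderGeneralization_nhdsKer _ hyx hx.1,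
        stableUnderGeneralization_nhdsKer _ hyx hx.2⟩)
      hU hCU
  exact ⟨interior A, interior B, A, B, isOpen_interior, isOpen_interior, hA, hB, hKA,
    interior_subset, hLB, interior_subset,
    (Set.inter_subset_inter subset_nhdsKer subset_nhdsKer).trans hAB⟩
end

section
/- Let A and B be meet-semilattices and let I : A → B and H : B → A be monotone functions with H ∘ I = id. Then H preserves binary meets (H(φ ⊓ ψ) = H φ ⊓ H ψ for all φ, ψ ∈ B) if and only if the composite E := I ∘ H satisfies E(φ ⊓ ψ) = E(E φ ⊓ E ψ) for all φ, ψ ∈ B. -/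
/-- For monotone `I : A → B`, `H : B → A` with `H ∘ I = id`, the map `H` preserves
binary meets iff `E = I ∘ H` satisfies `E (φ ⊓ ψ) = E (E φ ⊓ E ψ)`. -/
theorem retract_preserves_inf_iff {A B : Type*} [SemilatticeInf A] [SemilatticeInf B]
    (I : A → B) (H : B → A) (hI : Monotone I) (hH : Monotone H)
    (hHI : ∀ a : A, H (I a) = a) :
    (∀ φ ψ : B, H (φ ⊓ ψ) = H φ ⊓ H ψ) ↔
    (∀ φ ψ : B, I (H (φ ⊓ ψ)) = I (H (I (H φ) ⊓ I (H ψ)))) := by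
  constructor
  · intro h φ ψ
    rw [h, h, hHI, hHI]
  · intro h φ ψ
    refine le_antisymm (hH.map_inf_le φ ψ) ?_
    calc H φ ⊓ H ψ = H (I (H φ ⊓ H ψ)) := (hHI _).symm
      _ ≤ H (I (H φ) ⊓ I (H ψ)) := hH (hI.map_inf_le _ _)
      _ = H (φ ⊓ ψ) := (Function.LeftInverse.injective hHI (h φ ψ)).symm
end

section
/- Let N be a type and let 𝒰 denote the complete lattice of those subsets of Finset N that are upward closed under ⊆, ordered by inclusion. Let L be a complete lattice, H : 𝒰 → L a map preserving the top element, binary infima, and arbitrary suprema, and I : L → 𝒰 a monotone map preserving suprema of nonempty directed families, with H ∘ I = id. Then L is a continuous lattice (every φ ∈ L satisfies φ = sSup {β | β ≪ φ}) and L is distributive: a ⊓ sSup S = ⨆ b ∈ S, a ⊓ b for every a ∈ L and S ⊆ L. -/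
/-- If a complete lattice `L` is a retract of the lattice of upward-closed subsets of
`Finset N` (ordered by inclusion, with top `univ`, meet `∩` and suprema `⋃`), via a map
`H` preserving top, binary infima, and arbitrary suprema, split by a monotone `I`
preserving directed suprema, then `L` is a continuous distributive lattice. -/
theorem retract_of_upsets_is_continuous_distributive {N : Type*} {L : Type*}
    [CompleteLattice L] (H : Set (Finset N) → L) (I : L → Set (Finset N))
    (hIupper : ∀ φ : L, ∀ ℓ ℓ' : Finset N, ℓ ∈ I φ → ℓ ⊆ ℓ' → ℓ' ∈ I φ)
    (hHtop : H Set.univ = ⊤)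
    (hHinf : ∀ S T : Set (Finset N),
      (∀ ℓ ℓ' : Finset N, ℓ ∈ S → ℓ ⊆ ℓ' → ℓ' ∈ S) →
      (∀ ℓ ℓ' : Finset N, ℓ ∈ T → ℓ ⊆ ℓ' → ℓ' ∈ T) →
      H (S ∩ T) = H S ⊓ H T)
    (hHsup : ∀ 𝒮 : Set (Set (Finset N)),
      (∀ S ∈ 𝒮, ∀ ℓ ℓ' : Finset N, ℓ ∈ S → ℓ ⊆ ℓ' → ℓ' ∈ S) →
      H (⋃₀ 𝒮) = ⨆ S ∈ 𝒮, H S)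
    (hImono : Monotone I)
    (hIdir : ∀ D : Set L, D.Nonempty → DirectedOn (· ≤ ·) D →
      I (sSup D) = ⋃ φ ∈ D, I φ)
    (hHI : ∀ φ : L, H (I φ) = φ) :
    (∀ φ : L, φ = sSup {β | wayBelow β φ}) ∧
    (∀ (a : L) (S : Set L), a ⊓ sSup S = ⨆ b ∈ S, a ⊓ b) := by
  have hmono : ∀ S T : Set (Finset N),
      (∀ ℓ ℓ' : Finset N, ℓ ∈ S → ℓ ⊆ ℓ' → ℓ' ∈ S) →
      (∀ ℓ ℓ' : Finset N, ℓ ∈ T → ℓ ⊆ ℓ' → ℓ' ∈ T) →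
      S ⊆ T → H S ≤ H T := by
    intro S T hS hT hST
    have h := hHinf S T hS hT
    rw [Set.inter_eq_left.mpr hST] at h
    exact inf_eq_left.mp h.symm
  constructor
  · intro φ
    apply le_antisymm
    · have hunion : I φ = ⋃₀ ((fun ℓ => Set.Ici ℓ) '' I φ) := by
        ext m
        simp only [Set.sUnion_image, Set.mem_iUnion, Set.mem_Ici, exists_prop]
        exact ⟨fun hm => ⟨m, hm, le_rfl⟩, fun ⟨ℓ, hℓ, hle⟩ => hIupper φ ℓ m hℓ hle⟩
      have hsup : φ = ⨆ S ∈ (fun ℓ => Set.Ici ℓ) '' I φ, H S := by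
        rw [← hHsup, ← hunion, hHI]
        rintro _ ⟨ℓ, -, rfl⟩ m m' hm hle
        exact le_trans hm hle
      conv_lhs => rw [hsup]
      refine iSup₂_le ?_
      rintro _ ⟨ℓ, hℓ, rfl⟩
      refine le_sSup fun D hne hdir hle => ?_
      have hmem := hImono hle hℓ
      rw [hIdir D hne hdir] at hmem
      obtain ⟨d, hd, hℓd⟩ := Set.mem_iUnion₂.mp hmem
      refine ⟨d, hd, ?_⟩
      rw [← hHI d]
      exact hmono _ _ (fun m m' hm hle => le_trans hm hle) (hIupper d)
        fun m hm => hIupper d ℓ m hℓd hm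
    · refine sSup_le fun β hβ => ?_
      obtain ⟨d, rfl, hd⟩ := hβ {φ} (Set.singleton_nonempty φ)
        (directedOn_singleton φ) (by simp)
      exact hd
  · intro a S
    have hS : sSup S = H (⋃₀ (I '' S)) := by
      rw [hHsup, iSup_image, sSup_eq_iSup]
      · simp only [hHI]
      · rintro _ ⟨b, -, rfl⟩
        exact hIupper b
    have hunion : I a ∩ ⋃₀ (I '' S) = ⋃₀ ((fun b => I a ∩ I b) '' S) := by
      simp only [Set.sUnion_image, Set.inter_iUnion]
    calc a ⊓ sSup S = H (I a ∩ ⋃₀ (I '' S)) := by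
          rw [hHinf _ _ (hIupper a), hHI, hS]
          rintro ℓ ℓ' ⟨_, ⟨b, hb, rfl⟩, hℓ⟩ hle
          exact ⟨I b, ⟨b, hb, rfl⟩, hIupper b ℓ ℓ' hℓ hle⟩
      _ = ⨆ b ∈ S, H (I a ∩ I b) := by
          rw [hunion, hHsup, iSup_image]
          rintro _ ⟨b, -, rfl⟩ ℓ ℓ' hℓ hle
          exact ⟨hIupper a ℓ ℓ' hℓ.1 hle, hIupper b ℓ ℓ' hℓ.2 hle⟩
      _ = ⨆ b ∈ S, a ⊓ b := by
          simp only [hHinf _ _ (hIupper a) (hIupper _), hHI]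
end

section
/- Let X be a locally compact sober topological space, N a type, and U, K : N → Set X families with each U n open, each K n compact, U n ⊆ K n, and such that every open V ⊆ X satisfies V = ⋃ {U n | K n ⊆ V}. Then: (i) every open V ⊆ X equals the union, over all finite sets ℓ : Finset N satisfying ∃ n ∈ ℓ, K n ⊆ V, of the intersections ⋂ n ∈ ℓ, U n; (ii) the map I sending an open V to {ℓ : Finset N | ∃ n ∈ ℓ, K n ⊆ V} preserves directed unions: for every nonempty family of open sets (V_s) directed under inclusion, I (⋃ s, V_s) = ⋃ s, I (V_s). -/
/-- For compact sets `K n`, the assignment `V ↦ {ℓ | ∃ n ∈ ℓ, K n ⊆ V}` preserves directed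
unions of open sets, indexed by a type in any universe. -/
theorem setOf_finset_exists_subset_iUnion_of_directed {X N S : Type*} [TopologicalSpace X]
    [Nonempty S] {K : N → Set X} (hK : ∀ n, IsCompact (K n)) {V : S → Set X}
    (hV : ∀ s, IsOpen (V s)) (hdir : Directed (· ⊆ ·) V) :
    {ℓ : Finset N | ∃ n ∈ ℓ, K n ⊆ ⋃ s, V s} =
      ⋃ s : S, {ℓ : Finset N | ∃ n ∈ ℓ, K n ⊆ V s} := by
  ext ℓ
  simp only [Set.mem_ofPred_eq, Set.mem_iUnion]
  constructor
  · rintro ⟨n, hn, hsub⟩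
    obtain ⟨s, hs⟩ := (hK n).elim_directed_cover V hV hsub hdir
    exact ⟨s, n, hn, hs⟩
  · rintro ⟨s, n, hn, hs⟩
    exact ⟨n, hn, hs.trans (Set.subset_iUnion V s)⟩


/-- A locally compact sober space with a basis of pairs `U n ⊆ K n` of open and compact
sets embeds `Σ`-split into `P(N)`: every open `V` is the union of finite intersections
`⋂ n ∈ ℓ, U n` over finite sets `ℓ` containing some `n` with `K n ⊆ V`, and the
assignment `I V = {ℓ | ∃ n ∈ ℓ, K n ⊆ V}` preserves directed unions. -/
theorem basis_sigma_split_embedding {X : Type*} [TopologicalSpace X]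
    [LocallyCompactSpace X] [T0Space X] [QuasiSober X]
    {N : Type*} (U K : N → Set X)
    (hUopen : ∀ n, IsOpen (U n)) (hKcpt : ∀ n, IsCompact (K n))
    (hUK : ∀ n, U n ⊆ K n)
    (hbasis : ∀ V : Set X, IsOpen V → V = ⋃₀ {W | ∃ n, W = U n ∧ K n ⊆ V}) :
    (∀ V : Set X, IsOpen V →
      V = ⋃ ℓ ∈ {ℓ : Finset N | ∃ n ∈ ℓ, K n ⊆ V}, ⋂ n ∈ ℓ, U n) ∧
    (∀ (S : Type) (_ : Nonempty S) (V : S → Set X),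
      (∀ s, IsOpen (V s)) → (∀ s t : S, ∃ u : S, V s ⊆ V u ∧ V t ⊆ V u) →
      {ℓ : Finset N | ∃ n ∈ ℓ, K n ⊆ ⋃ s, V s} =
        ⋃ s : S, {ℓ : Finset N | ∃ n ∈ ℓ, K n ⊆ V s}) := by
  refine ⟨fun V hV => ?_, fun S _ V hV hdir =>
    setOf_finset_exists_subset_iUnion_of_directed hKcpt hV hdir⟩
  apply Set.Subset.antisymm
  · intro x hx
    rw [hbasis V hV] at hx
    obtain ⟨_, ⟨n, rfl, hn⟩, hxn⟩ := hx
    exact Set.mem_biUnion (x := {n}) ⟨n, Finset.mem_singleton_self n, hn⟩ (by simpa using hxn)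
  · refine Set.iUnion₂_subset ?_
    rintro ℓ ⟨n, hn, hsub⟩
    exact (Set.biInter_subset_of_mem hn).trans ((hUK n).trans hsub)
end

section
/- Let L be a complete lattice, N a type equipped with elements 0, 1 and binary operations + and ⋆, and β : N → L a family with β 0 = ⊥, β 1 = ⊤, β (n + m) = β n ⊔ β m, β (n ⋆ m) = β n ⊓ β m, and such that every φ ∈ L satisfies φ = sSup {b | ∃ n, b = β n ∧ b ≪ φ} (a lattice basis). Then the following are equivalent: (i) L is stably locally compact, i.e. ⊤ ≪ ⊤ and for all α, φ, ψ ∈ L, α ≪ φ and α ≪ ψ imply α ≪ φ ⊓ ψ; (ii) the basis is a filter basis, i.e. for every n, β n ≪ ⊤, and for all n and all φ, ψ ∈ L, β n ≪ φ and β n ≪ ψ imply β n ≪ φ ⊓ ψ. -/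
section WayBelow

variable {L : Type*} [CompleteLattice L] {a b c : L}

theorem wayBelow.of_le_left (hab : a ≤ b) (hbc : wayBelow b c) : wayBelow a c := by
  intro D hne hdir hle
  obtain ⟨d, hd, hbd⟩ := hbc D hne hdir hle
  exact ⟨d, hd, hab.trans hbd⟩

theorem wayBelow_bot_left (a : L) : wayBelow ⊥ a := by
  rintro D ⟨d, hd⟩ - -
  exact ⟨d, hd, bot_le⟩

theorem wayBelow.sup (hac : wayBelow a c) (hbc : wayBelow b c) : wayBelow (a ⊔ b) c := by
  intro D hne hdir hle
  obtain ⟨d, hd, had⟩ := hac D hne hdir hle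
  obtain ⟨e, he, hbe⟩ := hbc D hne hdir hle
  obtain ⟨f, hf, hdf, hef⟩ := hdir d hd e he
  exact ⟨f, hf, sup_le (had.trans hdf) (hbe.trans hef)⟩

/-- An element way below `c` lies under a basis element way below `c`, for any basis
containing `⊥` and closed under binary joins. -/
theorem wayBelow.exists_le_basis {N : Type*} {β : N → L} {z : N} {add : N → N → N}
    (hz : β z = ⊥) (hadd : ∀ n m : N, β (add n m) = β n ⊔ β m)
    (hc : c = sSup {b | ∃ n, b = β n ∧ wayBelow b c}) (hac : wayBelow a c) :
    ∃ n, a ≤ β n ∧ wayBelow (β n) c := by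
  obtain ⟨_, ⟨n, rfl, hn⟩, han⟩ := hac {b | ∃ n, b = β n ∧ wayBelow b c}
    ⟨⊥, z, hz.symm, wayBelow_bot_left c⟩
    (by
      rintro _ ⟨n, rfl, hn⟩ _ ⟨m, rfl, hm⟩
      exact ⟨β n ⊔ β m, ⟨add n m, (hadd n m).symm, hn.sup hm⟩, le_sup_left, le_sup_right⟩)
    hc.le
  exact ⟨n, han, hn⟩

end WayBelow

/-- A complete lattice with a lattice basis `β : N → L` is stably locally compact
(`⊤ ≪ ⊤` and `≪` closed under binary meets) iff the basis is a filter basis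
(each `β n ≪ ⊤` and `β n ≪ φ`, `β n ≪ ψ` imply `β n ≪ φ ⊓ ψ`). -/
theorem stably_locally_compact_iff_filter_basis {L : Type*} [CompleteLattice L]
    {N : Type*} (z o : N) (add mul : N → N → N) (β : N → L)
    (hz : β z = ⊥) (ho : β o = ⊤)
    (hadd : ∀ n m : N, β (add n m) = β n ⊔ β m)
    (hmul : ∀ n m : N, β (mul n m) = β n ⊓ β m)
    (hbasis : ∀ φ : L, φ = sSup {b | ∃ n, b = β n ∧ wayBelow b φ}) :
    (wayBelow (⊤ : L) ⊤ ∧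
      ∀ α φ ψ : L, wayBelow α φ → wayBelow α ψ → wayBelow α (φ ⊓ ψ)) ↔
    ((∀ n : N, wayBelow (β n) (⊤ : L)) ∧
      ∀ (n : N) (φ ψ : L), wayBelow (β n) φ → wayBelow (β n) ψ →
        wayBelow (β n) (φ ⊓ ψ)) := by
  constructor
  · rintro ⟨htop, hinf⟩
    exact ⟨fun n => htop.of_le_left le_top, fun n => hinf (β n)⟩
  · rintro ⟨htop, hinf⟩
    refine ⟨ho ▸ htop o, fun α φ ψ hφ hψ => ?_⟩
    obtain ⟨n, hαn, hn⟩ := hφ.exists_le_basis hz hadd (hbasis φ)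
    obtain ⟨m, hαm, hm⟩ := hψ.exists_le_basis hz hadd (hbasis ψ)
    refine wayBelow.of_le_left (b := β (mul n m)) ?_ (hinf _ φ ψ ?_ ?_)
    · exact hmul n m ▸ le_inf hαn hαm
    · exact hn.of_le_left (hmul n m ▸ inf_le_left)
    · exact hm.of_le_left (hmul n m ▸ inf_le_right)
end
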